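/- The trousers neighbourhood Morse geometry is causally discontinuous: let q = (x_q, m₂x_q) with x_q > 0 be a point on the branch {y = m₂x, x > 0} of the future light cone ∂F of the Morse point, and let s = (−a, 0) with 0 < a < ε. Then every point of I⁺(q) lies in the chronological future of s, and indeed s ∈ ↓I⁺(q), but s ∉ I⁻(q); hence I⁻(q) ≠ ↓I⁺(q), i.e. causal continuity fails at q. -/

import Mathlib

noncomputable section

open Set

/-- The punctured disc `N = {(x,y) : 0 < x² + y² < ε²}`. -/
def N2 (ε : ℝ) : Set (ℝ × ℝ) :=
  {p | 0 < p.1 ^ 2 + p.2 ^ 2 ∧ p.1 ^ 2 + p.2 ^ 2 < ε ^ 2}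

/-- The trousers Morse metric (quadratic form) built from `f(x,y) = y² − x²`. -/
def g2 (ζ : ℝ) (p w : ℝ × ℝ) : ℝ :=
  4 * ((p.2 ^ 2 - (ζ - 1) * p.1 ^ 2) * w.1 ^ 2 + 2 * ζ * p.1 * p.2 * w.1 * w.2 +
    (p.1 ^ 2 - (ζ - 1) * p.2 ^ 2) * w.2 ^ 2)

/-- The null coordinate `u(x,y) = √(ζ−1)(x²−y²) + 2xy`. -/
def uu (ζ : ℝ) (p : ℝ × ℝ) : ℝ :=
  Real.sqrt (ζ - 1) * (p.1 ^ 2 - p.2 ^ 2) + 2 * p.1 * p.2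

/-- The null coordinate `v(x,y) = √(ζ−1)(x²−y²) − 2xy`. -/
def vv (ζ : ℝ) (p : ℝ × ℝ) : ℝ :=
  Real.sqrt (ζ - 1) * (p.1 ^ 2 - p.2 ^ 2) - 2 * p.1 * p.2

def m1 (ζ : ℝ) : ℝ := (Real.sqrt ζ - 1) / Real.sqrt (ζ - 1)
def m2 (ζ : ℝ) : ℝ := (Real.sqrt ζ + 1) / Real.sqrt (ζ - 1)

/-- A future-directed timelike curve: a C¹ curve in `N` with everywhere timelike,
future-pointing tangent (`⟨∇f(γ), γ'⟩ = −2xγ₁' + 2yγ₂' > 0` where `f = y² − x²`). -/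
def Timelike2 (ζ ε : ℝ) (γ γ' : ℝ → ℝ × ℝ) : Prop :=
  (∀ t ∈ Icc (0 : ℝ) 1, HasDerivAt γ (γ' t) t) ∧
  ContinuousOn γ' (Icc (0 : ℝ) 1) ∧
  (∀ t ∈ Icc (0 : ℝ) 1, γ t ∈ N2 ε) ∧
  (∀ t ∈ Icc (0 : ℝ) 1, g2 ζ (γ t) (γ' t) < 0) ∧
  (∀ t ∈ Icc (0 : ℝ) 1, 0 < -2 * (γ t).1 * (γ' t).1 + 2 * (γ t).2 * (γ' t).2)

/-- The chronology relation `q ≪ p`. -/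
def chron2 (ζ ε : ℝ) (q p : ℝ × ℝ) : Prop :=
  ∃ γ γ', Timelike2 ζ ε γ γ' ∧ γ 0 = q ∧ γ 1 = p

def Iplus2 (ζ ε : ℝ) (q : ℝ × ℝ) : Set (ℝ × ℝ) := {p ∈ N2 ε | chron2 ζ ε q p}

def Iminus2 (ζ ε : ℝ) (q : ℝ × ℝ) : Set (ℝ × ℝ) := {p ∈ N2 ε | chron2 ζ ε p q}

/-- The common past `↓U` (interior in the open set `N` of the set of points
chronologically preceding every point of `U`). -/
def down2 (ζ ε : ℝ) (U : Set (ℝ × ℝ)) : Set (ℝ × ℝ) :=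
  interior {p ∈ N2 ε | ∀ u ∈ U, chron2 ζ ε p u}

/-- The complex number attached to a point of the plane. -/
def toC (p : ℝ × ℝ) : ℂ := ⟨p.1, p.2⟩

/-- The real linear forms giving `u` and `v` on the square `W = z²`. -/
def lu (ζ : ℝ) (W : ℂ) : ℝ := Real.sqrt (ζ - 1) * W.re + W.im
def lv (ζ : ℝ) (W : ℂ) : ℝ := Real.sqrt (ζ - 1) * W.re - W.im

lemma lu_sq (ζ : ℝ) (p : ℝ × ℝ) : lu ζ (toC p ^ 2) = uu ζ p := by
  simp [lu, uu, toC, pow_two]; ring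

lemma lv_sq (ζ : ℝ) (p : ℝ × ℝ) : lv ζ (toC p ^ 2) = vv ζ p := by
  simp [lv, vv, toC, pow_two]; ring

lemma norm_sq_toC (p : ℝ × ℝ) : ‖toC p ^ 2‖ = p.1 ^ 2 + p.2 ^ 2 := by
  rw [norm_pow, Complex.sq_norm, Complex.normSq_apply]; simp [toC]; ring

/-- The algebraic identity `g = - du dv`. -/
lemma g2_eq (ζ : ℝ) (hζ : 1 < ζ) (p w : ℝ × ℝ) :
    g2 ζ p w = - (lu ζ (2 * toC p * toC w) * lv ζ (2 * toC p * toC w)) := by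
  have h : Real.sqrt (ζ - 1) ^ 2 = ζ - 1 := Real.sq_sqrt (by linarith)
  simp [lu, lv, toC, g2]
  have : ζ = Real.sqrt (ζ - 1) ^ 2 + 1 := by linarith
  generalize Real.sqrt (ζ - 1) = c at *
  subst this
  ring

lemma grad_eq (p w : ℝ × ℝ) :
    -2 * p.1 * w.1 + 2 * p.2 * w.2 = - (2 * toC p * toC w).re := by
  simp [toC]; ring

lemma timelike_iff (ζ : ℝ) (hζ : 1 < ζ) (p w : ℝ × ℝ) :
    (g2 ζ p w < 0 ∧ 0 < -2 * p.1 * w.1 + 2 * p.2 * w.2) ↔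
    (lu ζ (2 * toC p * toC w) < 0 ∧ lv ζ (2 * toC p * toC w) < 0) := by
  have hc : 0 < Real.sqrt (ζ - 1) := Real.sqrt_pos.2 (by linarith)
  rw [g2_eq ζ hζ, grad_eq]
  have hs : lu ζ (2 * toC p * toC w) + lv ζ (2 * toC p * toC w) =
      2 * (Real.sqrt (ζ - 1) * (2 * toC p * toC w).re) := by simp only [lu, lv]; ring
  generalize lu ζ (2 * toC p * toC w) = a at *
  generalize lv ζ (2 * toC p * toC w) = b at *
  generalize (2 * toC p * toC w).re = r at *
  constructor
  · rintro ⟨h1, h2⟩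
    have h3 : a + b < 0 := by nlinarith
    constructor <;> nlinarith
  · rintro ⟨h1, h2⟩
    refine ⟨by nlinarith, ?_⟩
    by_contra h
    have : 0 ≤ Real.sqrt (ζ - 1) * r := mul_nonneg hc.le (by linarith)
    linarith

/-- Lifting a path of squares to the sheet `y > x`. -/
lemma lift_path (ζ ε : ℝ) (hζ : 1 < ζ) (W W' : ℝ → ℂ)
    (hW : ∀ t, HasDerivAt W (W' t) t) (hW' : Continuous W')
    (hslit : ∀ t ∈ Icc (0 : ℝ) 1, Complex.I * W t ∈ Complex.slitPlane)
    (hn : ∀ t ∈ Icc (0 : ℝ) 1, ‖W t‖ < ε ^ 2)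
    (hu : ∀ t ∈ Icc (0 : ℝ) 1, lu ζ (W' t) < 0)
    (hv : ∀ t ∈ Icc (0 : ℝ) 1, lv ζ (W' t) < 0)
    (s p : ℝ × ℝ) (hs : s.1 < s.2) (hp : p.1 < p.2)
    (h0 : W 0 = toC s ^ 2) (h1 : W 1 = toC p ^ 2) : chron2 ζ ε s p := by
  set r : ℝ := (Real.sqrt 2)⁻¹ with hr
  have hr0 : 0 < r := by positivity
  have hr2 : r ^ 2 = 1 / 2 := by rw [hr, inv_pow, Real.sq_sqrt (by norm_num)]; norm_num
  set κ : ℂ := ⟨-r, r⟩ with hκ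
  have hκ2 : κ ^ 2 = -Complex.I := by
    apply Complex.ext <;> simp [hκ, pow_two]
    nlinarith
  set R : ℝ → ℂ := fun t => Complex.exp (Complex.log (Complex.I * W t) / 2) with hR
  set z : ℝ → ℂ := fun t => κ * R t with hz
  set z' : ℝ → ℂ := fun t => W' t / (2 * z t) with hz'
  have hRre : ∀ t ∈ Icc (0 : ℝ) 1, 0 < (R t).re := by
    intro t ht
    simp only [hR, Complex.exp_re]
    apply mul_pos (Real.exp_pos _)
    have him : (Complex.log (Complex.I * W t) / 2).im = (Complex.I * W t).arg / 2 := by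
      rw [show (2 : ℂ) = ((2 : ℝ) : ℂ) by norm_num, Complex.div_ofReal_im, Complex.log_im]
    rw [him]
    have h1 := Complex.neg_pi_lt_arg (Complex.I * W t)
    have h2 := lt_of_le_of_ne (Complex.arg_le_pi (Complex.I * W t))
      (Complex.mem_slitPlane_iff_arg.1 (hslit t ht)).1
    apply Real.cos_pos_of_mem_Ioo
    constructor <;> linarith
  have hzsq : ∀ t ∈ Icc (0 : ℝ) 1, z t ^ 2 = W t := by
    intro t ht
    have hne := Complex.slitPlane_ne_zero (hslit t ht)
    simp only [hz, hR]
    rw [mul_pow, hκ2, ← Complex.exp_nat_mul]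
    rw [show ((2 : ℕ) : ℂ) * (Complex.log (Complex.I * W t) / 2) = Complex.log (Complex.I * W t) by
      push_cast; ring, Complex.exp_log hne, ← mul_assoc]
    simp
  have hz0 : ∀ t, z t ≠ 0 := by
    intro t
    apply mul_ne_zero _ (Complex.exp_ne_zero _)
    intro h
    have := congrArg Complex.im h
    simp [hκ] at this
    exact hr0.ne' this
  have hder : ∀ t ∈ Icc (0 : ℝ) 1, HasDerivAt z (z' t) t := by
    intro t ht
    have hWne : W t ≠ 0 := fun h => Complex.slitPlane_ne_zero (hslit t ht) (by simp [h])
    have h1 := ((hW t).const_mul Complex.I).clog_real (hslit t ht)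
    have h2 := ((h1.div_const 2).cexp).const_mul κ
    refine h2.congr_deriv ?_
    have e : κ * Complex.exp (Complex.log (Complex.I * W t) / 2) = z t := rfl
    rw [← mul_assoc, e]
    simp only [hz']
    rw [← hzsq t ht]
    field_simp [hz0 t, Complex.I_ne_zero]
  have hz'c : ContinuousOn z' (Icc 0 1) := by
    apply ContinuousOn.div hW'.continuousOn
    · exact continuousOn_const.mul (fun t ht => (hder t ht).continuousAt.continuousWithinAt)
    · intro t _; exact mul_ne_zero two_ne_zero (hz0 t)
  have hside : ∀ t ∈ Icc (0 : ℝ) 1, (z t).re < (z t).im := by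
    intro t ht
    have := hRre t ht
    simp only [hz, hκ, Complex.mul_re, Complex.mul_im]
    nlinarith
  have hend : ∀ t ∈ Icc (0 : ℝ) 1, ∀ s : ℝ × ℝ, s.1 < s.2 → W t = toC s ^ 2 →
      ((z t).re, (z t).im) = s := by
    intro t ht s hs h
    have h3 := (hzsq t ht).trans h
    have h4 := hside t ht
    rcases sq_eq_sq_iff_eq_or_eq_neg.1 h3 with h5 | h5
    · rw [h5]; simp [toC]
    · rw [h5] at h4; simp [toC] at h4; linarith
  refine ⟨fun t => ((z t).re, (z t).im), fun t => ((z' t).re, (z' t).im), ⟨?_, ?_, ?_, ?_⟩,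
    hend 0 (by simp) s hs h0, hend 1 (by simp) p hp h1⟩
  · intro t ht
    have h := (hder t ht)
    exact HasDerivAt.prodMk (Complex.reCLM.hasFDerivAt.comp_hasDerivAt t h)
      (Complex.imCLM.hasFDerivAt.comp_hasDerivAt t h)
  · exact (Complex.continuous_re.comp_continuousOn hz'c).prodMk
      (Complex.continuous_im.comp_continuousOn hz'c)
  · intro t ht
    have h := norm_sq_toC ((z t).re, (z t).im)
    have e : toC ((z t).re, (z t).im) = z t := rfl
    rw [e] at h
    have hpos : 0 < ‖z t ^ 2‖ := norm_pos_iff.2 (pow_ne_zero 2 (hz0 t))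
    have hlt := hn t ht
    rw [← hzsq t ht] at hlt
    rw [h] at hpos hlt
    exact ⟨hpos, hlt⟩
  · have key : ∀ t ∈ Icc (0 : ℝ) 1, _ := fun t ht =>
      (timelike_iff ζ hζ ((z t).re, (z t).im) ((z' t).re, (z' t).im)).2 (by
        have e : 2 * toC ((z t).re, (z t).im) * toC ((z' t).re, (z' t).im) = W' t := by
          change 2 * z t * z' t = W' t
          simp only [hz']
          field_simp [hz0 t]
        rw [e]; exact ⟨hu t ht, hv t ht⟩)
    exact ⟨fun t ht => (key t ht).1, fun t ht => (key t ht).2⟩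

lemma pow_half_lt (K k : ℝ) (hk : 0 < k) (hK : 0 ≤ K) :
    ∃ n : ℕ, (1 / 2 : ℝ) ^ (n + 1) * K < k := by
  obtain ⟨n, hn⟩ := exists_pow_lt_of_lt_one (show 0 < k / (K + 1) by positivity)
    (show (1 / 2 : ℝ) < 1 by norm_num)
  refine ⟨n, ?_⟩
  have h1 : (1 / 2 : ℝ) ^ (n + 1) ≤ (1 / 2 : ℝ) ^ n :=
    pow_le_pow_of_le_one (by norm_num) (by norm_num) (by omega)
  rw [lt_div_iff₀ (by positivity)] at hn
  have h2 : 0 < (1 / 2 : ℝ) ^ n := by positivity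
  nlinarith

/-- The main connecting lemma. -/
lemma connect (ζ ε : ℝ) (hζ : 1 < ζ) (s p : ℝ × ℝ) (hsN : s ∈ N2 ε) (hpN : p ∈ N2 ε)
    (hs : s.1 < s.2) (hp : p.1 < p.2) (hus : 0 < uu ζ s) (hvs : 0 < vv ζ s)
    (hup : uu ζ p < 0) (hvp : vv ζ p < 0) : chron2 ζ ε s p := by
  have hS := norm_sq_toC s
  have hP := norm_sq_toC p
  rw [← lu_sq] at hus hup
  rw [← lv_sq] at hvs hvp
  have hSn : ‖toC s ^ 2‖ < ε ^ 2 := by rw [hS]; exact hsN.2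
  have hPn : ‖toC p ^ 2‖ < ε ^ 2 := by rw [hP]; exact hpN.2
  have hε2 : 0 < ε ^ 2 := hsN.1.trans hsN.2
  generalize hSd : toC s ^ 2 = S at *
  generalize hPd : toC p ^ 2 = P at *
  obtain ⟨δ, hδ0, hδ⟩ := exists_between
    (show 0 < min (ε ^ 2) (min (lv ζ S) (-lu ζ P)) from lt_min hε2 (lt_min hvs (by linarith)))
  have hδ1 : δ < ε ^ 2 := hδ.trans_le (min_le_left _ _)
  have hδ2 : δ < lv ζ S := hδ.trans_le ((min_le_right _ _).trans (min_le_left _ _))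
  have hδ3 : δ < -lu ζ P := hδ.trans_le ((min_le_right _ _).trans (min_le_right _ _))
  obtain ⟨n, hn⟩ := pow_half_lt (lu ζ S + δ + δ - lv ζ P) δ hδ0 (by linarith)
  set M : ℂ := ⟨0, -δ⟩ with hM
  have hMn : ‖M‖ = δ := by
    have : M = ((-δ : ℝ) : ℂ) * Complex.I := by apply Complex.ext <;> simp [hM]
    rw [this, norm_mul, Complex.norm_real, Complex.norm_I, Real.norm_eq_abs, abs_neg,
      abs_of_pos hδ0, mul_one]
  set A : ℝ → ℝ := fun t => (1 - t) ^ (n + 1) with hA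
  set B : ℝ → ℝ := fun t => t ^ (n + 1) with hB
  set W : ℝ → ℂ := fun t => M + A t • (S - M) + B t • (P - M) with hWd
  set W' : ℝ → ℂ := fun t => ((n + 1 : ℝ) * (1 - t) ^ n) • (M - S) +
    ((n + 1 : ℝ) * t ^ n) • (P - M) with hWd'
  have hA' : ∀ t, HasDerivAt A (-((n + 1 : ℝ) * (1 - t) ^ n)) t := by
    intro t
    have := ((hasDerivAt_id t).const_sub 1).pow (n + 1)
    refine this.congr_deriv ?_
    simp
  have hB' : ∀ t, HasDerivAt B ((n + 1 : ℝ) * t ^ n) t := by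
    intro t
    have := (hasDerivAt_id t).pow (n + 1)
    refine this.congr_deriv ?_
    simp
  have luW : ∀ t, lu ζ (W t) = A t * lu ζ S - (1 - A t - B t) * δ + B t * lu ζ P := by
    intro t; simp [lu, hWd, hM]; ring
  have lvW : ∀ t, lv ζ (W t) = A t * lv ζ S + (1 - A t - B t) * δ + B t * lv ζ P := by
    intro t; simp [lv, hWd, hM]; ring
  have luW' : ∀ t, lu ζ (W' t) = ((n + 1 : ℝ) * (1 - t) ^ n) * (-δ - lu ζ S) +
      ((n + 1 : ℝ) * t ^ n) * (lu ζ P + δ) := by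
    intro t; simp only [lu, hWd', hM, Complex.add_re, Complex.add_im, Complex.smul_re, Complex.smul_im, Complex.sub_re, Complex.sub_im, smul_eq_mul]; ring
  have lvW' : ∀ t, lv ζ (W' t) = ((n + 1 : ℝ) * (1 - t) ^ n) * (δ - lv ζ S) +
      ((n + 1 : ℝ) * t ^ n) * (lv ζ P - δ) := by
    intro t; simp only [lv, hWd', hM, Complex.add_re, Complex.add_im, Complex.smul_re, Complex.smul_im, Complex.sub_re, Complex.sub_im, smul_eq_mul]; ring
  have hA0 : ∀ t ∈ Icc (0 : ℝ) 1, 0 ≤ A t := fun t ht => pow_nonneg (by linarith [ht.2]) _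
  have hB0 : ∀ t ∈ Icc (0 : ℝ) 1, 0 ≤ B t := fun t ht => pow_nonneg ht.1 _
  have hAB : ∀ t ∈ Icc (0 : ℝ) 1, A t + B t ≤ 1 := by
    intro t ht
    have h1 : A t ≤ 1 - t := pow_le_of_le_one (by linarith [ht.2]) (by linarith [ht.1]) (by omega)
    have h2 : B t ≤ t := pow_le_of_le_one ht.1 ht.2 (by omega)
    linarith
  have hneg : ∀ t ∈ Icc (0 : ℝ) 1, ∀ a b : ℝ, a < 0 → b < 0 →
      ((n + 1 : ℝ) * (1 - t) ^ n) * a + ((n + 1 : ℝ) * t ^ n) * b < 0 := by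
    intro t ht a b ha hb
    have h1 : 0 ≤ (n + 1 : ℝ) * (1 - t) ^ n :=
      mul_nonneg (by positivity) (pow_nonneg (by linarith [ht.2]) _)
    have h2 : 0 ≤ (n + 1 : ℝ) * t ^ n := mul_nonneg (by positivity) (pow_nonneg ht.1 _)
    rcases eq_or_lt_of_le ht.1 with h | h
    · have : 0 < (n + 1 : ℝ) * (1 - t) ^ n := by rw [← h]; simp; positivity
      nlinarith
    · have : 0 < (n + 1 : ℝ) * t ^ n := by positivity
      nlinarith
  apply lift_path ζ ε hζ W W' (s := s) (p := p) (hs := hs) (hp := hp)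
  · intro t
    have h := (((hA' t).smul_const (S - M)).const_add M).add ((hB' t).smul_const (P - M))
    refine h.congr_deriv ?_
    simp only [hWd', neg_smul, smul_sub]; abel
  · simp only [hWd']; fun_prop
  · intro t ht
    have hor : 0 < lv ζ (W t) ∨ lu ζ (W t) < 0 := by
      have a0 := hA0 t ht
      have b0 := hB0 t ht
      have ab := hAB t ht
      rcases le_total t (1 / 2) with h | h
      · left
        have hb : B t ≤ (1 / 2 : ℝ) ^ (n + 1) := pow_le_pow_left₀ ht.1 h _
        rw [lvW]
        nlinarith [mul_nonneg a0 (sub_nonneg.2 hδ2.le),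
          mul_le_mul_of_nonneg_right hb (show 0 ≤ δ - lv ζ P by linarith),
          mul_nonneg (show (0 : ℝ) ≤ (1 / 2 : ℝ) ^ (n + 1) by positivity)
            (show 0 ≤ lu ζ S + δ by linarith)]
      · right
        have hb : A t ≤ (1 / 2 : ℝ) ^ (n + 1) :=
          pow_le_pow_left₀ (by linarith [ht.2]) (by linarith) _
        rw [luW]
        nlinarith [mul_nonneg b0 (show 0 ≤ -lu ζ P - δ by linarith),
          mul_le_mul_of_nonneg_right hb (show 0 ≤ lu ζ S + δ by linarith),
          mul_nonneg (show (0 : ℝ) ≤ (1 / 2 : ℝ) ^ (n + 1) by positivity)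
            (show 0 ≤ δ - lv ζ P by linarith)]
    rw [Complex.mem_slitPlane_iff]
    by_cases h : (W t).re = 0
    · left
      simp only [lu, lv, h, mul_zero] at hor
      simp only [Complex.mul_re, Complex.I_re, Complex.I_im]
      rcases hor with h | h <;> linarith
    · right
      simpa using h
  · intro t ht
    have a0 := hA0 t ht
    have b0 := hB0 t ht
    have ab := hAB t ht
    have e : W t = A t • S + (1 - A t - B t) • M + B t • P := by
      simp only [hWd, smul_sub, sub_smul, one_smul]; abel
    have hle : ‖W t‖ ≤ A t * ‖S‖ + (1 - A t - B t) * ‖M‖ + B t * ‖P‖ := by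
      rw [e]
      refine (norm_add₃_le).trans_eq ?_
      rw [norm_smul, norm_smul, norm_smul, Real.norm_of_nonneg a0, Real.norm_of_nonneg b0,
        Real.norm_of_nonneg (show 0 ≤ 1 - A t - B t by linarith)]
    obtain ⟨D, hD1, hD2⟩ := exists_between (max_lt hSn (max_lt hPn hδ1))
    have d1 : ‖S‖ ≤ D := (le_max_left _ _).trans hD1.le
    have d2 : ‖P‖ ≤ D := ((le_max_left _ _).trans (le_max_right _ _)).trans hD1.le
    have d3 : ‖M‖ ≤ D := hMn ▸ ((le_max_right _ _).trans (le_max_right _ _)).trans hD1.le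
    have := mul_le_mul_of_nonneg_left d1 a0
    have := mul_le_mul_of_nonneg_left d2 b0
    have := mul_le_mul_of_nonneg_left d3 (show 0 ≤ 1 - A t - B t by linarith)
    nlinarith
  · intro t ht
    rw [luW']
    exact hneg t ht _ _ (by linarith) (by linarith)
  · intro t ht
    rw [lvW']
    exact hneg t ht _ _ (by linarith) (by linarith)
  · rw [hSd]; simp [hWd, hA, hB]
  · rw [hPd]; simp [hWd, hA, hB]

lemma anti_uv (ζ ε : ℝ) (hζ : 1 < ζ) (γ γ' : ℝ → ℝ × ℝ) (h : Timelike2 ζ ε γ γ') :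
    StrictAntiOn (fun t => uu ζ (γ t)) (Icc 0 1) ∧
    StrictAntiOn (fun t => vv ζ (γ t)) (Icc 0 1) := by
  obtain ⟨hd, -, -, hg, hf⟩ := h
  have d1 : ∀ t ∈ Icc (0 : ℝ) 1, HasDerivAt (fun t => (γ t).1) (γ' t).1 t := fun t ht =>
    (ContinuousLinearMap.fst ℝ ℝ ℝ).hasFDerivAt.comp_hasDerivAt t (hd t ht)
  have d2 : ∀ t ∈ Icc (0 : ℝ) 1, HasDerivAt (fun t => (γ t).2) (γ' t).2 t := fun t ht =>
    (ContinuousLinearMap.snd ℝ ℝ ℝ).hasFDerivAt.comp_hasDerivAt t (hd t ht)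
  have du : ∀ t ∈ Icc (0 : ℝ) 1, HasDerivAt (fun t => uu ζ (γ t))
      (lu ζ (2 * toC (γ t) * toC (γ' t))) t := by
    intro t ht
    have h := (((d1 t ht).pow 2).sub ((d2 t ht).pow 2)).const_mul (Real.sqrt (ζ - 1)) |>.add
      (((d1 t ht).const_mul 2).mul (d2 t ht))
    refine h.congr_deriv ?_
    simp [lu, toC]; ring
  have dv : ∀ t ∈ Icc (0 : ℝ) 1, HasDerivAt (fun t => vv ζ (γ t))
      (lv ζ (2 * toC (γ t) * toC (γ' t))) t := by
    intro t ht
    have h := (((d1 t ht).pow 2).sub ((d2 t ht).pow 2)).const_mul (Real.sqrt (ζ - 1)) |>.sub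
      (((d1 t ht).const_mul 2).mul (d2 t ht))
    refine h.congr_deriv ?_
    simp [lv, toC]; ring
  have key := fun t ht => (timelike_iff ζ hζ (γ t) (γ' t)).1 ⟨hg t ht, hf t ht⟩
  constructor
  · apply strictAntiOn_of_deriv_neg (convex_Icc 0 1)
    · exact fun t ht => (du t ht).continuousAt.continuousWithinAt
    · intro t ht
      have ht := interior_subset ht
      rw [(du t ht).deriv]; exact (key t ht).1
  · apply strictAntiOn_of_deriv_neg (convex_Icc 0 1)
    · exact fun t ht => (dv t ht).continuousAt.continuousWithinAt
    · intro t ht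
      have ht := interior_subset ht
      rw [(dv t ht).deriv]; exact (key t ht).2

lemma m2_facts (ζ : ℝ) (hζ : 1 < ζ) : 0 < m2 ζ ∧
    Real.sqrt (ζ - 1) * (m2 ζ ^ 2 - 1) = 2 * m2 ζ := by
  have hc : 0 < Real.sqrt (ζ - 1) := Real.sqrt_pos.2 (by linarith)
  have h : Real.sqrt (ζ - 1) ^ 2 = ζ - 1 := Real.sq_sqrt (by linarith)
  have h' : Real.sqrt ζ ^ 2 = ζ := Real.sq_sqrt (by linarith)
  have h0 := Real.sqrt_nonneg ζ
  refine ⟨by unfold m2; positivity, ?_⟩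
  unfold m2
  field_simp
  nlinarith

lemma uv_q (ζ : ℝ) (hζ : 1 < ζ) (x : ℝ) (hx : 0 < x) :
    uu ζ (x, m2 ζ * x) = 0 ∧ vv ζ (x, m2 ζ * x) < 0 := by
  obtain ⟨hm, h⟩ := m2_facts ζ hζ
  have e1 : uu ζ (x, m2 ζ * x) = 0 := by
    simp only [uu]; linear_combination (-x ^ 2) * h
  refine ⟨e1, ?_⟩
  have e2 : vv ζ (x, m2 ζ * x) = uu ζ (x, m2 ζ * x) - 4 * m2 ζ * x ^ 2 := by
    simp only [uu, vv]; ring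
  rw [e2, e1]
  have : 0 < m2 ζ * x ^ 2 := by positivity
  linarith

/-- Every point in the future of `q` lies in the region `u < 0`, `v < 0`, `y > x`. -/
lemma future_q (ζ ε : ℝ) (hζ : 1 < ζ) (x : ℝ) (hx : 0 < x) (p : ℝ × ℝ)
    (h : chron2 ζ ε (x, m2 ζ * x) p) : uu ζ p < 0 ∧ vv ζ p < 0 ∧ p.1 < p.2 := by
  obtain ⟨γ, γ', hγ, h0, h1⟩ := h
  obtain ⟨au, av⟩ := anti_uv ζ ε hζ γ γ' hγ
  obtain ⟨q1, q2⟩ := uv_q ζ hζ x hx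
  have hc : 0 < Real.sqrt (ζ - 1) := Real.sqrt_pos.2 (by linarith)
  have hu : ∀ t ∈ Icc (0 : ℝ) 1, uu ζ (γ t) ≤ 0 := by
    intro t ht
    have := au.antitoneOn (by simp) ht ht.1
    simp only [h0, q1] at this
    exact this
  have hv : ∀ t ∈ Icc (0 : ℝ) 1, vv ζ (γ t) < 0 := by
    intro t ht
    have := av.antitoneOn (by simp) ht ht.1
    simp only [h0] at this
    exact this.trans_lt q2
  have hX : ∀ t ∈ Icc (0 : ℝ) 1, (γ t).1 ^ 2 < (γ t).2 ^ 2 := by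
    intro t ht
    have h1 := hu t ht
    have h2 := hv t ht
    simp only [uu, vv] at h1 h2
    by_contra hcon
    have := mul_nonneg hc.le (sub_nonneg.2 (not_lt.1 hcon))
    linarith
  have up : uu ζ p < 0 := by
    have := au (show (0 : ℝ) ∈ Icc (0 : ℝ) 1 by simp) (show (1 : ℝ) ∈ Icc (0 : ℝ) 1 by simp)
      one_pos
    simp only [h0, h1, q1] at this
    exact this
  have vp : vv ζ p < 0 := by have := hv 1 (by simp); rwa [h1] at this
  refine ⟨up, vp, ?_⟩
  have hcont : ContinuousOn (fun t => (γ t).2) (Icc 0 1) := fun t ht =>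
    (hγ.1 t ht).continuousAt.snd.continuousWithinAt
  have hy : 0 < p.2 := by
    by_contra hcon
    have h2 : (0 : ℝ) ∈ Icc ((γ 1).2) ((γ 0).2) := by
      rw [h0, h1]
      exact ⟨not_lt.1 hcon, (mul_pos (m2_facts ζ hζ).1 hx).le⟩
    obtain ⟨t, ht, hty⟩ := intermediate_value_Icc' zero_le_one hcont h2
    have := hX t ht
    simp only at hty
    rw [hty] at this
    nlinarith [sq_nonneg (γ t).1]
  have := hX 1 (by simp)
  rw [h1] at this
  nlinarith

lemma not_past (ζ ε : ℝ) (hζ : 1 < ζ) (x a : ℝ) (hx : 0 < x) (ha : 0 < a) :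
    ¬ chron2 ζ ε (-a, 0) (x, m2 ζ * x) := by
  rintro ⟨γ, γ', hγ, h0, h1⟩
  obtain ⟨au, -⟩ := anti_uv ζ ε hζ γ γ' hγ
  obtain ⟨q1, -⟩ := uv_q ζ hζ x hx
  obtain ⟨hm, hme⟩ := m2_facts ζ hζ
  have hc : 0 < Real.sqrt (ζ - 1) := Real.sqrt_pos.2 (by linarith)
  have hu : ∀ t ∈ Icc (0 : ℝ) 1, 0 ≤ uu ζ (γ t) := by
    intro t ht
    have := au.antitoneOn ht (by simp) ht.2
    simp only [h1, q1] at this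
    exact this
  have hcont : ContinuousOn (fun t => (m2 ζ * (γ t).1 - (γ t).2) + ((γ t).1 + m2 ζ * (γ t).2))
      (Icc 0 1) := by
    have c1 : ContinuousOn (fun t => (γ t).1) (Icc 0 1) := fun t ht =>
      (hγ.1 t ht).continuousAt.fst.continuousWithinAt
    have c2 : ContinuousOn (fun t => (γ t).2) (Icc 0 1) := fun t ht =>
      (hγ.1 t ht).continuousAt.snd.continuousWithinAt
    fun_prop
  obtain ⟨t, ht, hty⟩ := intermediate_value_Icc zero_le_one hcont (show (0 : ℝ) ∈ _ by
    simp only [h0, h1]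
    constructor
    · nlinarith
    · nlinarith [mul_pos hm (mul_pos hm hx)])
  simp only at hty
  have h2 := hu t ht
  have h3 := (hγ.2.2.1 t ht).1
  simp only [uu] at h2
  generalize (γ t).1 = X at *
  generalize (γ t).2 = Y at *
  have e : m2 ζ * (Real.sqrt (ζ - 1) * (X ^ 2 - Y ^ 2) + 2 * X * Y) =
      -(Real.sqrt (ζ - 1) * (m2 ζ * X - Y) ^ 2) := by
    linear_combination (-X * Y) * hme + Real.sqrt (ζ - 1) * (m2 ζ * X - Y) * hty
  have h4 := mul_nonneg hm.le h2
  rw [e] at h4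
  have h5 : (m2 ζ * X - Y) ^ 2 = 0 := by
    by_contra hne
    have := mul_pos hc (lt_of_le_of_ne (sq_nonneg (m2 ζ * X - Y)) (Ne.symm hne))
    linarith
  have h6 : m2 ζ * X - Y = 0 := pow_eq_zero_iff (two_ne_zero) |>.1 h5
  have h7 : X * (1 + m2 ζ ^ 2) = 0 := by linear_combination hty + (m2 ζ - 1) * h6
  have h8 : X = 0 := by
    rcases mul_eq_zero.1 h7 with h | h
    · exact h
    · nlinarith [sq_nonneg (m2 ζ)]
  have h9 : Y = 0 := by rw [h8] at h6; linarith
  rw [h8, h9] at h3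
  norm_num at h3

/-- causal discontinuity of the trousers. With `q = (x_q, m₂x_q)`,
`x_q > 0`, on the future light cone of the Morse point and `s = (−a, 0)` with
`0 < a < ε`: every point of `I⁺(q)` lies to the chronological future of `s`,
indeed `s ∈ ↓I⁺(q)`, but `s ∉ I⁻(q)`; hence `I⁻(q) ≠ ↓I⁺(q)`. -/
theorem stmt4 (ζ ε : ℝ) (hζ : 1 < ζ) (hε : 0 < ε) (xq a : ℝ) (hxq : 0 < xq)
    (hq : (xq, m2 ζ * xq) ∈ N2 ε) (ha : 0 < a) (haε : a < ε) :
    (∀ p ∈ Iplus2 ζ ε (xq, m2 ζ * xq), chron2 ζ ε (-a, 0) p) ∧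
    (-a, 0) ∈ down2 ζ ε (Iplus2 ζ ε (xq, m2 ζ * xq)) ∧
    (-a, 0) ∉ Iminus2 ζ ε (xq, m2 ζ * xq) ∧
    Iminus2 ζ ε (xq, m2 ζ * xq) ≠ down2 ζ ε (Iplus2 ζ ε (xq, m2 ζ * xq)) := by
  have hc : 0 < Real.sqrt (ζ - 1) := Real.sqrt_pos.2 (by linarith)
  have main : ∀ s ∈ N2 ε, s.1 < s.2 → 0 < uu ζ s → 0 < vv ζ s →
      ∀ p ∈ Iplus2 ζ ε (xq, m2 ζ * xq), chron2 ζ ε s p := by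
    intro s hs h1 h2 h3 p hp
    obtain ⟨f1, f2, f3⟩ := future_q ζ ε hζ xq hxq p hp.2
    exact connect ζ ε hζ s p hs hp.1 h1 f3 h2 h3 f1 f2
  have sN : ((-a, 0) : ℝ × ℝ) ∈ N2 ε := by
    refine ⟨?_, ?_⟩
    · simp only; nlinarith
    · simp only; nlinarith
  have s1 : ((-a, 0) : ℝ × ℝ).1 < ((-a, 0) : ℝ × ℝ).2 := by simp only; linarith
  have s2 : 0 < uu ζ (-a, 0) := by
    have : uu ζ (-a, 0) = Real.sqrt (ζ - 1) * a ^ 2 := by simp only [uu]; ring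
    rw [this]; positivity
  have s3 : 0 < vv ζ (-a, 0) := by
    have : vv ζ (-a, 0) = Real.sqrt (ζ - 1) * a ^ 2 := by simp only [vv]; ring
    rw [this]; positivity
  have hdown : (-a, 0) ∈ down2 ζ ε (Iplus2 ζ ε (xq, m2 ζ * xq)) := by
    rw [down2, mem_interior]
    refine ⟨{p | (0 < p.1 ^ 2 + p.2 ^ 2 ∧ p.1 ^ 2 + p.2 ^ 2 < ε ^ 2) ∧ p.1 < p.2 ∧
      0 < uu ζ p ∧ 0 < vv ζ p}, ?_, ?_, ⟨sN, s1, s2, s3⟩⟩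
    · rintro p ⟨h1, h2, h3, h4⟩
      exact ⟨h1, main p h1 h2 h3 h4⟩
    · have cu : Continuous (uu ζ) := by unfold uu; fun_prop
      have cv : Continuous (vv ζ) := by unfold vv; fun_prop
      refine IsOpen.and (IsOpen.and ?_ ?_) (IsOpen.and ?_ (IsOpen.and ?_ ?_))
      · exact isOpen_lt (by fun_prop) (by fun_prop)
      · exact isOpen_lt (by fun_prop) (by fun_prop)
      · exact isOpen_lt (by fun_prop) (by fun_prop)
      · exact isOpen_lt (by fun_prop) cu
      · exact isOpen_lt (by fun_prop) cv
  have hnot : (-a, 0) ∉ Iminus2 ζ ε (xq, m2 ζ * xq) := fun h =>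
    not_past ζ ε hζ xq a hxq ha h.2
  refine ⟨main _ sN s1 s2 s3, hdown, hnot, ?_⟩
  intro h
  rw [h] at hnot
  exact hnot hdown
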